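/- The maximum variance satisfies V_max(A, αA) = A²·γ, where γ = max over vectors (q_1,…,q_n) with q_k ≥ 0 for all k, ∑_{k=1}^n q_k ≤ 1 and ∑_{k=1}^n k·q_k ≤ α, of ( ∑_{k=1}^n s_k² q_k − ( ∑_{k=1}^n s_k q_k )² ). -/

import Mathlib

open MeasureTheory ProbabilityTheory Real Filter
open scoped NNReal ENNReal Classical

noncomputable section

/-- Kullback–Leibler divergence (Mathlib's `ProbabilityTheory.klDiv`). -/
def klDiv {α : Type*} [MeasurableSpace α] (μ ν : Measure α) : EReal :=
  if μ ≪ ν ∧ Integrable (llr μ ν) μ then ((∫ x, llr μ ν x ∂μ : ℝ) : EReal) else ⊤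

/-- Mutual information of a joint law: KL divergence of the joint law from the
product of its marginals. -/
def mutualInfo {α β : Type*} [MeasurableSpace α] [MeasurableSpace β]
    (joint : Measure (α × β)) : EReal :=
  klDiv joint ((joint.map Prod.fst).prod (joint.map Prod.snd))

/-- Partial sums `s_k = h_1 + ⋯ + h_k`. -/
def sCum {n : ℕ} (h : Fin n → ℝ) (k : ℕ) : ℝ :=
  ∑ i : Fin n, if i.val < k then h i else 0

/-- Joint law of `(X, Y)` with `Y = hᵀX + Z`, `Z ~ N(0, v)` independent of `X`. -/
def misoJoint {n : ℕ} (h : Fin n → ℝ) (v : ℝ≥0) (μ : Measure (Fin n → ℝ)) :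
    Measure ((Fin n → ℝ) × ℝ) :=
  (μ.prod (gaussianReal 0 v)).map (fun p => (p.1, (∑ k, h k * p.1 k) + p.2))

/-- MISO capacity under peak-power constraint `A` and average-power constraint `E`. -/
def misoCapacity {n : ℕ} (h : Fin n → ℝ) (v : ℝ≥0) (A E : ℝ) : EReal :=
  ⨆ μ ∈ {μ : Measure (Fin n → ℝ) | IsProbabilityMeasure μ ∧
      (∀ k, ∀ᵐ x ∂μ, x k ∈ Set.Icc 0 A) ∧ (∑ k, ∫ x, x k ∂μ) ≤ E},
    mutualInfo (misoJoint h v μ)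

/-- MISO capacity under only an average-power constraint `E`. -/
def misoCapacityAvg {n : ℕ} (h : Fin n → ℝ) (v : ℝ≥0) (E : ℝ) : EReal :=
  ⨆ μ ∈ {μ : Measure (Fin n → ℝ) | IsProbabilityMeasure μ ∧
      (∀ k, ∀ᵐ x ∂μ, 0 ≤ x k) ∧ (∑ k, ∫ x, x k ∂μ) ≤ E},
    mutualInfo (misoJoint h v μ)

/-- Joint law of `(X̄, X̄ + Z)` for the unit-gain SISO channel. -/
def sisoJoint (v : ℝ≥0) (μ : Measure ℝ) : Measure (ℝ × ℝ) :=
  (μ.prod (gaussianReal 0 v)).map (fun p => (p.1, p.1 + p.2))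

/-- Unit-gain SISO capacity under peak-power constraint `A` and average-power
constraint `E`. -/
def sisoCapacity (v : ℝ≥0) (A E : ℝ) : EReal :=
  ⨆ μ ∈ {μ : Measure ℝ | IsProbabilityMeasure μ ∧
      (∀ᵐ x ∂μ, x ∈ Set.Icc 0 A) ∧ (∫ x, x ∂μ) ≤ E},
    mutualInfo (sisoJoint v μ)

/-- Unit-gain SISO capacity under only an average-power constraint `E`. -/
def sisoCapacityAvg (v : ℝ≥0) (E : ℝ) : EReal :=
  ⨆ μ ∈ {μ : Measure ℝ | IsProbabilityMeasure μ ∧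
      (∀ᵐ x ∂μ, 0 ≤ x) ∧ (∫ x, x ∂μ) ≤ E},
    mutualInfo (sisoJoint v μ)

/-- The interval `(s_{k-1} A, s_k A]` (with the first one being `[0, s_1 A]`)
corresponding to the event `U = k` (0-indexed: `k ∈ Fin n` stands for `k+1`). -/
def uInterval {n : ℕ} (h : Fin n → ℝ) (A : ℝ) (k : Fin n) : Set ℝ :=
  if k.val = 0 then Set.Icc 0 (sCum h 1 * A)
  else Set.Ioc (sCum h k.val * A) (sCum h (k.val + 1) * A)

/-- The average input power `∑_k p_k ((E[X̄ | U=k] - A s_{k-1})/h_k + (k-1) A)`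
consumed to generate a scalar law of `X̄`. -/
def avgPowerUse {n : ℕ} (h : Fin n → ℝ) (A : ℝ) (μ : Measure ℝ) : ℝ :=
  ∑ k : Fin n,
    (((∫ x in uInterval h A k, x ∂μ) - A * sCum h k.val * (μ (uInterval h A k)).toReal) / h k
      + (k.val : ℝ) * A * (μ (uInterval h A k)).toReal)

/-- The threshold `α_th`. -/
def alphaTh {n : ℕ} (h : Fin n → ℝ) : ℝ :=
  1 / 2 + (1 / sCum h n) * ∑ k : Fin n, h k * (k.val : ℝ)


/-- A scalar law is admissible if it is a probability measure, is supported on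
nonnegative reals, puts no mass above `s_n A`, and respects the average-power
constraint `αA`. -/
def scalarAdmissible {n : ℕ} (h : Fin n → ℝ) (A αA : ℝ) (μ : Measure ℝ) : Prop :=
  IsProbabilityMeasure μ ∧ (∀ᵐ x ∂μ, 0 ≤ x) ∧ μ {x | sCum h n * A < x} = 0 ∧
    avgPowerUse h A μ ≤ αA

/-- The maximum variance `V_max(A, αA)`. -/
def Vmax {n : ℕ} (h : Fin n → ℝ) (A αA : ℝ) : ℝ :=
  sSup ((fun μ : Measure ℝ => variance id μ) '' {μ | scalarAdmissible h A αA μ})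

end

lemma sCum_zero {n : ℕ} (h : Fin n → ℝ) : sCum h 0 = 0 := by simp [sCum]

lemma sCum_mono {n : ℕ} {h : Fin n → ℝ} (hpos : ∀ k, 0 < h k) : Monotone (sCum h) := by
  intro a b hab
  refine Finset.sum_le_sum fun i _ => ?_
  have := (hpos i).le
  split_ifs <;> first | omega | linarith

lemma sCum_nonneg {n : ℕ} {h : Fin n → ℝ} (hpos : ∀ k, 0 < h k) (k : ℕ) : 0 ≤ sCum h k :=
  sCum_zero h ▸ sCum_mono hpos k.zero_le

lemma sCum_succ {n : ℕ} (h : Fin n → ℝ) (k : Fin n) :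
    sCum h (k.val + 1) = sCum h k.val + h k := by
  have hk : h k = ∑ i : Fin n, if i = k then h i else 0 := by simp
  rw [hk, sCum, sCum, ← Finset.sum_add_distrib]
  refine Finset.sum_congr rfl fun i _ => ?_
  have := Fin.ext_iff (a := i) (b := k)
  split_ifs <;> first | omega | simp

lemma sCum_succ_size {n : ℕ} (h : Fin n → ℝ) : sCum h (n + 1) = sCum h n := by
  refine Finset.sum_congr rfl fun i _ => ?_
  have := i.isLt
  rw [if_pos (by omega), if_pos (by omega)]

lemma bounds_of_mem_uInterval {n : ℕ} {h : Fin n → ℝ} {A x : ℝ} {k : Fin n}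
    (hx : x ∈ uInterval h A k) :
    sCum h k.val * A ≤ x ∧ x ≤ sCum h (k.val + 1) * A := by
  unfold uInterval at hx
  split_ifs at hx with hk
  · simpa [hk, sCum_zero] using hx
  · exact ⟨hx.1.le, hx.2⟩

lemma measurableSet_uInterval {n : ℕ} (h : Fin n → ℝ) (A : ℝ) (k : Fin n) :
    MeasurableSet (uInterval h A k) := by
  unfold uInterval
  split_ifs
  · exact measurableSet_Icc
  · exact measurableSet_Ioc

lemma exists_mem_uInterval {n : ℕ} (hn : 0 < n) {h : Fin n → ℝ} {A x : ℝ}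
    (hA : 0 < A) (hpos : ∀ k, 0 < h k) (hx0 : 0 ≤ x) (hxn : x ≤ sCum h n * A) :
    ∃ k : Fin n, x ∈ uInterval h A k := by
  have hex : ∃ m, x ≤ sCum h m * A := ⟨n, hxn⟩
  have hspec := Nat.find_spec hex
  have hle : Nat.find hex ≤ n := Nat.find_min' hex hxn
  rcases Nat.eq_zero_or_pos (Nat.find hex) with h0 | h0
  · refine ⟨⟨0, hn⟩, ?_⟩
    rw [h0, sCum_zero, zero_mul] at hspec
    simp only [uInterval, if_true]
    exact ⟨hx0, hspec.trans (mul_nonneg (sCum_nonneg hpos 1) hA.le)⟩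
  · refine ⟨⟨Nat.find hex - 1, by omega⟩, ?_⟩
    have hlt := Nat.find_min hex (m := Nat.find hex - 1) (by omega)
    have hm : Nat.find hex - 1 + 1 = Nat.find hex := by omega
    rw [not_le] at hlt
    by_cases h1 : Nat.find hex - 1 = 0
    · simp only [uInterval, h1, if_true]
      refine ⟨hx0, ?_⟩
      rwa [← hm, h1] at hspec
    · simp only [uInterval, if_neg h1, hm]
      exact ⟨hlt, hspec⟩

lemma pairwise_disjoint_uInterval {n : ℕ} {h : Fin n → ℝ} {A : ℝ}
    (hA : 0 < A) (hpos : ∀ k, 0 < h k) : Pairwise (Function.onFun Disjoint (uInterval h A)) := by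
  have key : ∀ j k : Fin n, j < k → Disjoint (uInterval h A j) (uInterval h A k) := by
    intro j k hjk
    rw [Set.disjoint_left]
    intro x hj hk
    have hjk' : j.val < k.val := hjk
    rw [uInterval, if_neg (by omega)] at hk
    have h1 := (bounds_of_mem_uInterval hj).2
    have h2 := mul_le_mul_of_nonneg_right (sCum_mono hpos (Nat.succ_le_of_lt hjk')) hA.le
    have h3 := hk.1
    simp only [Nat.succ_eq_add_one] at h2
    linarith
  intro j k hjk
  rcases lt_or_gt_of_ne hjk with hlt | hlt
  · exact key j k hlt
  · exact (key k j hlt).symm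

/-- The fraction of the segment `[s_j A, s_{j+1} A]` that lies below `x`. -/
noncomputable def segFrac {n : ℕ} (h : Fin n → ℝ) (A : ℝ) (j : ℕ) (x : ℝ) : ℝ :=
  max 0 (min 1 ((x / A - sCum h j) / (sCum h (j + 1) - sCum h j)))

lemma segFrac_nonneg {n : ℕ} (h : Fin n → ℝ) (A : ℝ) (j : ℕ) (x : ℝ) : 0 ≤ segFrac h A j x :=
  le_max_left _ _

lemma segFrac_le_one {n : ℕ} (h : Fin n → ℝ) (A : ℝ) (j : ℕ) (x : ℝ) : segFrac h A j x ≤ 1 :=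
  max_le zero_le_one (min_le_left _ _)

lemma segFrac_size {n : ℕ} (h : Fin n → ℝ) (A x : ℝ) : segFrac h A n x = 0 := by
  simp [segFrac, sCum_succ_size]

lemma continuous_segFrac {n : ℕ} (h : Fin n → ℝ) (A : ℝ) (j : ℕ) :
    Continuous (segFrac h A j) := by
  unfold segFrac
  fun_prop

lemma segFrac_eq_one {n : ℕ} {h : Fin n → ℝ} {A x : ℝ} (hA : 0 < A) (hpos : ∀ k, 0 < h k)
    {j : ℕ} (hj : j < n) (hx : sCum h (j + 1) * A ≤ x) : segFrac h A j x = 1 := by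
  have hs := sCum_succ h ⟨j, hj⟩
  have hp := hpos ⟨j, hj⟩
  have h1 : 1 ≤ (x / A - sCum h j) / (sCum h (j + 1) - sCum h j) := by
    rw [le_div_iff₀ (by simp only at hs; linarith)]
    have := (le_div_iff₀ hA).2 hx
    linarith
  rw [segFrac, min_eq_left h1, max_eq_right zero_le_one]

lemma segFrac_eq_zero {n : ℕ} {h : Fin n → ℝ} {A x : ℝ} (hA : 0 < A) (hpos : ∀ k, 0 < h k)
    {j : ℕ} (hx : x ≤ sCum h j * A) : segFrac h A j x = 0 := by
  refine max_eq_left ((min_le_right _ _).trans (div_nonpos_of_nonpos_of_nonneg ?_ ?_))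
  · have := (div_le_iff₀ hA).2 hx
    linarith
  · exact sub_nonneg.2 (sCum_mono hpos (Nat.le_succ j))

lemma segFrac_succ_le {n : ℕ} {h : Fin n → ℝ} {A : ℝ} (hA : 0 < A) (hpos : ∀ k, 0 < h k)
    {j : ℕ} (hj : j < n) (x : ℝ) : segFrac h A (j + 1) x ≤ segFrac h A j x := by
  rcases le_total x (sCum h (j + 1) * A) with hx | hx
  · rw [segFrac_eq_zero hA hpos hx]
    exact segFrac_nonneg _ _ _ _
  · rw [segFrac_eq_one hA hpos hj hx]
    exact segFrac_le_one _ _ _ _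

/-- The piecewise linear interpolation of `s_j A ↦ f j - f 0`. -/
noncomputable def interp {n : ℕ} (h : Fin n → ℝ) (A : ℝ) (f : ℕ → ℝ) (x : ℝ) : ℝ :=
  ∑ j ∈ Finset.range n, (f (j + 1) - f j) * segFrac h A j x

lemma interp_eq {n : ℕ} {h : Fin n → ℝ} {A x : ℝ} (hA : 0 < A) (hpos : ∀ k, 0 < h k)
    (f : ℕ → ℝ) {k : Fin n} (hl : sCum h k.val * A ≤ x) (hu : x ≤ sCum h (k.val + 1) * A) :
    interp h A f x =
      f k.val - f 0 + (f (k.val + 1) - f k.val) * ((x / A - sCum h k.val) / h k) := by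
  have hk : segFrac h A k.val x = (x / A - sCum h k.val) / h k := by
    have h1 := (le_div_iff₀ hA).2 hl
    have h2 := (div_le_iff₀ hA).2 hu
    have hs := sCum_succ h k
    rw [segFrac, hs, add_sub_cancel_left, min_eq_right, max_eq_right]
    · exact div_nonneg (by linarith) (hpos k).le
    · rw [div_le_one (hpos k)]
      linarith
  have key : ∀ m ≤ n, ∑ j ∈ Finset.range m, (f (j + 1) - f j) * segFrac h A j x =
      if m ≤ k.val then f m - f 0
      else f k.val - f 0 + (f (k.val + 1) - f k.val) * ((x / A - sCum h k.val) / h k) := by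
    intro m
    induction m with
    | zero => simp
    | succ m ih =>
      intro hm
      rw [Finset.sum_range_succ, ih (by omega)]
      rcases lt_trichotomy m k.val with hlt | heq | hgt
      · rw [if_pos hlt.le, if_pos (Nat.succ_le_of_lt hlt), segFrac_eq_one hA hpos hm]
        · ring
        · exact (mul_le_mul_of_nonneg_right (sCum_mono hpos hlt) hA.le).trans hl
      · rw [if_pos heq.le, if_neg (by omega), heq, hk]
      · rw [if_neg (by omega), if_neg (by omega), segFrac_eq_zero hA hpos, mul_zero, add_zero]
        exact hu.trans (mul_le_mul_of_nonneg_right (sCum_mono hpos hgt) hA.le)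
  rw [interp, key n le_rfl, if_neg (by have := k.isLt; omega)]

lemma interp_node {n : ℕ} {h : Fin n → ℝ} {A : ℝ} (hA : 0 < A) (hpos : ∀ k, 0 < h k)
    (f : ℕ → ℝ) (k : Fin n) :
    interp h A f (sCum h (k.val + 1) * A) = f (k.val + 1) - f 0 := by
  rw [interp_eq hA hpos f
    (mul_le_mul_of_nonneg_right (sCum_mono hpos (Nat.le_succ k.val)) hA.le) le_rfl,
    mul_div_cancel_right₀ _ hA.ne', sCum_succ, add_sub_cancel_left, div_self (hpos k).ne']
  ring

lemma interp_zero {n : ℕ} {h : Fin n → ℝ} {A : ℝ} (hA : 0 < A) (hpos : ∀ k, 0 < h k)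
    (f : ℕ → ℝ) : interp h A f 0 = 0 :=
  Finset.sum_eq_zero fun j _ => by
    rw [segFrac_eq_zero hA hpos (mul_nonneg (sCum_nonneg hpos j) hA.le), mul_zero]

lemma integrable_segFrac {n : ℕ} (h : Fin n → ℝ) (A : ℝ) (j : ℕ) (μ : Measure ℝ)
    [IsFiniteMeasure μ] : Integrable (segFrac h A j) μ := by
  refine Integrable.of_bound (continuous_segFrac h A j).aestronglyMeasurable 1 (.of_forall ?_)
  intro x
  rw [Real.norm_of_nonneg (segFrac_nonneg _ _ _ _)]
  exact segFrac_le_one _ _ _ _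

lemma integrable_interp {n : ℕ} (h : Fin n → ℝ) (A : ℝ) (f : ℕ → ℝ) (μ : Measure ℝ)
    [IsFiniteMeasure μ] : Integrable (interp h A f) μ :=
  integrable_finsetSum _ fun j _ => (integrable_segFrac h A j μ).const_mul _

lemma integral_interp {n : ℕ} (h : Fin n → ℝ) (A : ℝ) (f : ℕ → ℝ) (μ : Measure ℝ)
    [IsFiniteMeasure μ] :
    ∫ x, interp h A f x ∂μ =
      ∑ j ∈ Finset.range n, (f (j + 1) - f j) * ∫ x, segFrac h A j x ∂μ := by
  unfold interp
  rw [integral_finsetSum _ fun j _ => (integrable_segFrac h A j μ).const_mul _]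
  simp only [integral_const_mul]

lemma sum_range_by_parts (f c : ℕ → ℝ) (m : ℕ) :
    ∑ j ∈ Finset.range m, f (j + 1) * (c j - c (j + 1)) =
      ∑ j ∈ Finset.range m, (f (j + 1) - f j) * c j - f m * c m + f 0 * c 0 := by
  induction m with
  | zero => simp
  | succ m ih => rw [Finset.sum_range_succ, Finset.sum_range_succ, ih]; ring

lemma ae_mem_uInterval {n : ℕ} (hn : 0 < n) {h : Fin n → ℝ} {A : ℝ}
    (hA : 0 < A) (hpos : ∀ k, 0 < h k) {μ : Measure ℝ} (h0 : ∀ᵐ x ∂μ, 0 ≤ x)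
    (htop : μ {x | sCum h n * A < x} = 0) : ∀ᵐ x ∂μ, ∃ k, x ∈ uInterval h A k := by
  have htop' : ∀ᵐ x ∂μ, x ≤ sCum h n * A := by
    rw [ae_iff]
    simpa only [not_le] using htop
  filter_upwards [h0, htop'] with x hx0 hx1
  exact exists_mem_uInterval hn hA hpos hx0 hx1

lemma memLp_id_of_support {n : ℕ} {h : Fin n → ℝ} {A : ℝ} {μ : Measure ℝ}
    [IsFiniteMeasure μ] (h0 : ∀ᵐ x ∂μ, 0 ≤ x) (htop : μ {x | sCum h n * A < x} = 0) :
    MemLp (id : ℝ → ℝ) 2 μ := by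
  have htop' : ∀ᵐ x ∂μ, x ≤ sCum h n * A := by
    rw [ae_iff]
    simpa only [not_le] using htop
  refine MemLp.of_bound measurable_id.aestronglyMeasurable (sCum h n * A) ?_
  filter_upwards [h0, htop'] with x hx0 hx1
  rwa [id, Real.norm_of_nonneg hx0]

lemma avgPowerUse_eq_integral {n : ℕ} (hn : 0 < n) {h : Fin n → ℝ} {A : ℝ}
    (hA : 0 < A) (hpos : ∀ k, 0 < h k) {μ : Measure ℝ} [IsFiniteMeasure μ]
    (h0 : ∀ᵐ x ∂μ, 0 ≤ x) (htop : μ {x | sCum h n * A < x} = 0) :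
    avgPowerUse h A μ = A * ∫ x, interp h A (fun k => (k : ℝ)) x ∂μ := by
  have hid : Integrable (fun x : ℝ => x) μ :=
    (memLp_id_of_support h0 htop).integrable one_le_two
  have hI := integrable_interp h A (fun k => (k : ℝ)) μ
  have hterm : ∀ k : Fin n,
      ((∫ x in uInterval h A k, x ∂μ) - A * sCum h k.val * (μ (uInterval h A k)).toReal) / h k
        + (k.val : ℝ) * A * (μ (uInterval h A k)).toReal =
      ∫ x in uInterval h A k, A * interp h A (fun k => (k : ℝ)) x ∂μ := by
    intro k
    have hc : ∀ c : ℝ, c * (μ (uInterval h A k)).toReal = ∫ _ in uInterval h A k, c ∂μ := by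
      intro c
      rw [setIntegral_const, smul_eq_mul, mul_comm, Measure.real]
    have hsub : Integrable (fun x => (x - A * sCum h k.val) / h k)
        (μ.restrict (uInterval h A k)) :=
      (hid.integrableOn.sub (integrable_const _)).div_const _
    rw [hc, hc, ← integral_sub hid.integrableOn (integrable_const _), ← integral_div,
      ← integral_add hsub (integrable_const _)]
    refine setIntegral_congr_fun (measurableSet_uInterval h A k) fun x hx => ?_
    obtain ⟨hl, hu⟩ := bounds_of_mem_uInterval hx
    have hk := (hpos k).ne'
    simp only [interp_eq hA hpos _ hl hu]
    push_cast
    field_simp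
    ring
  rw [avgPowerUse, Finset.sum_congr rfl fun k _ => hterm k,
    ← integral_iUnion_fintype (measurableSet_uInterval h A) (pairwise_disjoint_uInterval hA hpos)
      (fun k => (hI.const_mul A).integrableOn), Measure.restrict_eq_self_of_ae_mem,
    integral_const_mul]
  filter_upwards [ae_mem_uInterval hn hA hpos h0 htop] with x hx
  exact Set.mem_iUnion.2 hx

/-- Moving the mass at each point to the endpoints of its segment preserves the mean and the
power use, and does not decrease the variance. -/
lemma exists_weights_of_admissible {n : ℕ} (hn : 0 < n) {h : Fin n → ℝ} {A α : ℝ}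
    (hA : 0 < A) (hpos : ∀ k, 0 < h k) {μ : Measure ℝ} (hμ : scalarAdmissible h A (α * A) μ) :
    ∃ q : Fin n → ℝ, (∀ k, 0 ≤ q k) ∧ (∑ k, q k) ≤ 1 ∧
      (∑ k : Fin n, ((k.val : ℝ) + 1) * q k) ≤ α ∧
      variance id μ ≤ A ^ 2 * (∑ k : Fin n, (sCum h (k.val + 1)) ^ 2 * q k
        - (∑ k : Fin n, sCum h (k.val + 1) * q k) ^ 2) := by
  obtain ⟨hprob, h0, htop, hpow⟩ := hμ
  rw [avgPowerUse_eq_integral hn hA hpos h0 htop] at hpow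
  set c : ℕ → ℝ := fun j => ∫ x, segFrac h A j x ∂μ with hc
  have hcn : c n = 0 := by simp [hc, segFrac_size]
  have hsum : ∀ f : ℕ → ℝ, f 0 = 0 →
      ∑ k : Fin n, f (k.val + 1) * (c k.val - c (k.val + 1)) = ∫ x, interp h A f x ∂μ := by
    intro f hf
    rw [integral_interp, Fin.sum_univ_eq_sum_range (fun j => f (j + 1) * (c j - c (j + 1))) n,
      sum_range_by_parts, hcn, hf]
    ring
  have hmean : A * ∫ x, interp h A (sCum h) x ∂μ = ∫ x, x ∂μ := by
    rw [← integral_const_mul]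
    refine integral_congr_ae ?_
    filter_upwards [ae_mem_uInterval hn hA hpos h0 htop] with x ⟨k, hx⟩
    obtain ⟨hl, hu⟩ := bounds_of_mem_uInterval hx
    have hk := (hpos k).ne'
    rw [interp_eq hA hpos _ hl hu, sCum_succ, sCum_zero]
    field_simp
    ring
  have hsq : ∫ x, x ^ 2 ∂μ ≤ A ^ 2 * ∫ x, interp h A (fun k => sCum h k ^ 2) x ∂μ := by
    rw [← integral_const_mul]
    refine integral_mono_ae (memLp_id_of_support h0 htop).integrable_sq
      ((integrable_interp _ _ _ _).const_mul _) ?_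
    filter_upwards [ae_mem_uInterval hn hA hpos h0 htop] with x ⟨k, hx⟩
    obtain ⟨hl, hu⟩ := bounds_of_mem_uInterval hx
    have hk := hpos k
    have h1 := (le_div_iff₀ hA).2 hl
    have h2 := (div_le_iff₀ hA).2 hu
    rw [interp_eq hA hpos _ hl hu, sCum_succ, sCum_zero]
    rw [sCum_succ] at h2
    obtain ⟨t, ht⟩ : ∃ t, t = (x / A - sCum h k.val) / h k := ⟨_, rfl⟩
    have ht0 : 0 ≤ t := ht ▸ div_nonneg (by linarith) hk.le
    have ht1 : t ≤ 1 := by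
      rw [ht, div_le_one hk]
      linarith
    have hxt : x = A * (sCum h k.val + t * h k) := by
      rw [ht]
      field_simp
      ring
    rw [← ht, hxt, mul_pow]
    refine mul_le_mul_of_nonneg_left ?_ (sq_nonneg A)
    nlinarith [mul_nonneg (mul_nonneg ht0 (sub_nonneg.2 ht1)) (sq_nonneg (h k))]
  have hc0 : c 0 ≤ 1 := by
    have := integral_mono (integrable_segFrac h A 0 μ) (integrable_const (1 : ℝ))
      (segFrac_le_one h A 0)
    simpa using this
  refine ⟨fun k => c k.val - c (k.val + 1), fun k => ?_, ?_, ?_, ?_⟩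
  · exact sub_nonneg.2 (integral_mono (integrable_segFrac _ _ _ _) (integrable_segFrac _ _ _ _)
      (segFrac_succ_le hA hpos k.isLt))
  · rw [Fin.sum_univ_eq_sum_range (fun j => c j - c (j + 1)) n, Finset.sum_range_sub', hcn]
    linarith
  · have := hsum (fun k => (k : ℝ)) (by simp)
    push_cast at this
    rw [this]
    exact le_of_mul_le_mul_left (by linarith) hA
  · rw [hsum (fun k => sCum h k ^ 2) (by simp [sCum_zero]), hsum (sCum h) (sCum_zero h),
      variance_eq_sub (memLp_id_of_support h0 htop), mul_sub, ← mul_pow, hmean]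
    simpa using hsq

/-- The law with mass `q_k` at `s_k A` and the remaining mass at `0`. -/
noncomputable def nodeLaw {n : ℕ} (h : Fin n → ℝ) (A : ℝ) (q : Fin n → ℝ) : Measure ℝ :=
  ENNReal.ofReal (1 - ∑ k, q k) • Measure.dirac 0 +
    ∑ k : Fin n, ENNReal.ofReal (q k) • Measure.dirac (sCum h (k.val + 1) * A)

lemma integral_nodeLaw {n : ℕ} (h : Fin n → ℝ) (A : ℝ) {q : Fin n → ℝ} (hq : ∀ k, 0 ≤ q k)
    (hq1 : ∑ k, q k ≤ 1) (f : ℝ → ℝ) :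
    ∫ x, f x ∂(nodeLaw h A q) =
      (1 - ∑ k, q k) * f 0 + ∑ k : Fin n, q k * f (sCum h (k.val + 1) * A) := by
  have hd : ∀ (c a : ℝ), Integrable f (ENNReal.ofReal c • Measure.dirac a) := fun c a =>
    (integrable_dirac (by simp)).smul_measure ENNReal.ofReal_ne_top
  rw [nodeLaw, integral_add_measure (hd _ _) (integrable_finsetSum_measure.2 fun k _ => hd _ _),
    integral_finsetSum_measure fun k _ => hd _ _]
  simp only [integral_smul_measure, integral_dirac, smul_eq_mul]
  rw [ENNReal.toReal_ofReal (by linarith)]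
  simp only [ENNReal.toReal_ofReal (hq _)]

lemma isProbabilityMeasure_nodeLaw {n : ℕ} (h : Fin n → ℝ) (A : ℝ) {q : Fin n → ℝ}
    (hq : ∀ k, 0 ≤ q k) (hq1 : ∑ k, q k ≤ 1) : IsProbabilityMeasure (nodeLaw h A q) := by
  constructor
  simp only [nodeLaw, Measure.add_apply, Measure.smul_apply, Measure.finsetSum_apply,
    measure_univ, smul_eq_mul, mul_one]
  rw [← ENNReal.ofReal_sum_of_nonneg fun k _ => hq k,
    ← ENNReal.ofReal_add (by linarith) (Finset.sum_nonneg fun k _ => hq k)]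
  simp

lemma nodeLaw_eq_zero {n : ℕ} (h : Fin n → ℝ) (A : ℝ) (q : Fin n → ℝ) {s : Set ℝ}
    (hs : MeasurableSet s) (h0 : (0 : ℝ) ∉ s) (hk : ∀ k : Fin n, sCum h (k.val + 1) * A ∉ s) :
    nodeLaw h A q s = 0 := by
  simp [nodeLaw, hs, h0, hk]

lemma nodeLaw_admissible {n : ℕ} (hn : 0 < n) {h : Fin n → ℝ} {A α : ℝ}
    (hA : 0 < A) (hpos : ∀ k, 0 < h k) {q : Fin n → ℝ} (hq : ∀ k, 0 ≤ q k)
    (hq1 : ∑ k, q k ≤ 1) (hqα : ∑ k : Fin n, ((k.val : ℝ) + 1) * q k ≤ α) :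
    scalarAdmissible h A (α * A) (nodeLaw h A q) ∧
      variance id (nodeLaw h A q) = A ^ 2 * (∑ k : Fin n, (sCum h (k.val + 1)) ^ 2 * q k
        - (∑ k : Fin n, sCum h (k.val + 1) * q k) ^ 2) := by
  have hprob := isProbabilityMeasure_nodeLaw h A hq hq1
  have hnode : ∀ k : Fin n, 0 ≤ sCum h (k.val + 1) * A := fun k =>
    mul_nonneg (sCum_nonneg hpos _) hA.le
  have h0 : ∀ᵐ x ∂(nodeLaw h A q), 0 ≤ x := by
    rw [ae_iff]
    refine nodeLaw_eq_zero h A q (measurableSet_le measurable_const measurable_id).compl ?_ ?_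
    · simp
    · intro k
      simpa using hnode k
  have htop : nodeLaw h A q {x | sCum h n * A < x} = 0 := by
    refine nodeLaw_eq_zero h A q measurableSet_Ioi ?_ ?_
    · simpa using mul_nonneg (sCum_nonneg hpos n) hA.le
    · intro k
      simpa only [Set.mem_ofPred_eq, not_lt] using
        mul_le_mul_of_nonneg_right (sCum_mono hpos k.isLt) hA.le
  refine ⟨⟨hprob, h0, htop, ?_⟩, ?_⟩
  · rw [avgPowerUse_eq_integral hn hA hpos h0 htop, integral_nodeLaw h A hq hq1,
      interp_zero hA hpos, mul_comm]
    refine mul_le_mul_of_nonneg_right (le_trans (le_of_eq ?_) hqα) hA.le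
    simp only [interp_node hA hpos]
    rw [mul_zero, zero_add]
    refine Finset.sum_congr rfl fun k _ => ?_
    push_cast
    ring
  · rw [variance_eq_sub (memLp_id_of_support h0 htop)]
    have h1 := integral_nodeLaw h A hq hq1 id
    have h2 := integral_nodeLaw h A hq hq1 (id ^ 2)
    rw [h1, h2]
    simp only [Pi.pow_apply, id, mul_sub, ← mul_pow, Finset.mul_sum]
    simp only [ne_eq, OfNat.ofNat_ne_zero, not_false_eq_true, zero_pow, mul_zero, zero_add]
    congr 1
    · exact Finset.sum_congr rfl fun k _ => by ring
    · congr 1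
      exact Finset.sum_congr rfl fun k _ => by ring

theorem max_variance_eq_gamma (n : ℕ) (hn : 2 ≤ n) (h : Fin n → ℝ)
    (hord : ∀ i j : Fin n, i ≤ j → h j ≤ h i) (hpos : ∀ k, 0 < h k)
    (A α : ℝ) (hA : 0 < A) (hα0 : 0 < α) (hαn : α < (n : ℝ) / 2)
    (γ : ℝ)
    (hγ : γ = sSup {x : ℝ | ∃ q : Fin n → ℝ, (∀ k, 0 ≤ q k) ∧ (∑ k, q k) ≤ 1 ∧
      (∑ k : Fin n, ((k.val : ℝ) + 1) * q k) ≤ α ∧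
      x = ∑ k : Fin n, (sCum h (k.val + 1)) ^ 2 * q k
        - (∑ k : Fin n, sCum h (k.val + 1) * q k) ^ 2}) :
    Vmax h A (α * A) = A ^ 2 * γ := by
  have hn0 : 0 < n := by omega
  set S : Set ℝ := {x : ℝ | ∃ q : Fin n → ℝ, (∀ k, 0 ≤ q k) ∧ (∑ k, q k) ≤ 1 ∧
      (∑ k : Fin n, ((k.val : ℝ) + 1) * q k) ≤ α ∧
      x = ∑ k : Fin n, (sCum h (k.val + 1)) ^ 2 * q k
        - (∑ k : Fin n, sCum h (k.val + 1) * q k) ^ 2} with hS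
  have hbdd : BddAbove S := by
    refine ⟨sCum h n ^ 2, ?_⟩
    rintro x ⟨q, hq, hq1, -, rfl⟩
    have h1 : ∑ k : Fin n, (sCum h (k.val + 1)) ^ 2 * q k ≤ ∑ k, sCum h n ^ 2 * q k :=
      Finset.sum_le_sum fun k _ => mul_le_mul_of_nonneg_right
        (pow_le_pow_left₀ (sCum_nonneg hpos _) (sCum_mono hpos k.isLt) 2) (hq k)
    rw [← Finset.mul_sum] at h1
    nlinarith [sq_nonneg (sCum h n), sq_nonneg (∑ k : Fin n, sCum h (k.val + 1) * q k)]
  have hmem : ∀ x ∈ S, A ^ 2 * x ∈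
      (fun μ : Measure ℝ => variance id μ) '' {μ | scalarAdmissible h A (α * A) μ} := by
    rintro x ⟨q, hq, hq1, hqα, rfl⟩
    obtain ⟨hadm, hvar⟩ := nodeLaw_admissible hn0 hA hpos hq hq1 hqα
    exact ⟨_, hadm, hvar⟩
  have hub : ∀ y ∈ (fun μ : Measure ℝ => variance id μ) '' {μ | scalarAdmissible h A (α * A) μ},
      y ≤ A ^ 2 * sSup S := by
    rintro y ⟨μ, hμ, rfl⟩
    obtain ⟨q, hq, hq1, hqα, hvar⟩ := exists_weights_of_admissible hn0 hA hpos hμ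
    exact hvar.trans (mul_le_mul_of_nonneg_left
      (le_csSup hbdd ⟨q, hq, hq1, hqα, rfl⟩) (sq_nonneg A))
  have hne : S.Nonempty := ⟨0, 0, by simp, by simp, by simpa using hα0.le, by simp⟩
  have hA2 : 0 < A ^ 2 := by positivity
  rw [hγ, Vmax]
  refine le_antisymm (csSup_le (hne.elim fun x hx => ⟨_, hmem x hx⟩) hub) ?_
  rw [← le_div_iff₀' hA2]
  refine csSup_le hne fun x hx => ?_
  rw [le_div_iff₀' hA2]
  exact le_csSup ⟨_, hub⟩ (hmem x hx)
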